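/- Let K(x,y) = K₁(x₁,y₁) + K₂(x₂,y₂) be a symmetric additive kernel on ℝ², let x⁽¹⁾ = (a₁,a₂), x⁽²⁾ = (b₁,a₂), x⁽³⁾ = (a₁,b₂) be three corners of a rectangle and x⁽⁴⁾ = (b₁,b₂) the fourth corner. Let K be the 3×3 matrix with entries K_{j,l} = K(x⁽ʲ⁾, x⁽ˡ⁾), assumed invertible, and let k(x) = (K(x, x⁽¹⁾), K(x, x⁽²⁾), K(x, x⁽³⁾))ᵀ. Then the simple kriging prediction variance at x⁽⁴⁾ vanishes: v(x⁽⁴⁾) := K(x⁽⁴⁾, x⁽⁴⁾) − k(x⁽⁴⁾)ᵀ K⁻¹ k(x⁽⁴⁾) = 0, even though x⁽⁴⁾ is not one of the three design points. -/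

import Mathlib

open Matrix

/-- For an additive kernel on ℝ², a design made of three corners of a rectangle with
invertible covariance matrix, the simple kriging prediction variance at the fourth
corner `x⁽⁴⁾ = (b₁,b₂)` vanishes, although `x⁽⁴⁾` is not a design point. -/
theorem additive_kriging_variance_vanishes_at_fourth_corner
    (K₁ K₂ : ℝ → ℝ → ℝ)
    (hsym₁ : ∀ s t, K₁ s t = K₁ t s) (hsym₂ : ∀ s t, K₂ s t = K₂ t s)
    (a₁ b₁ a₂ b₂ : ℝ)
    (X : Fin 3 → ℝ × ℝ)
    (hX : X = ![(a₁, a₂), (b₁, a₂), (a₁, b₂)])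
    (Kmat : Matrix (Fin 3) (Fin 3) ℝ)
    (hKmat : Kmat = Matrix.of fun j l => K₁ (X j).1 (X l).1 + K₂ (X j).2 (X l).2)
    (hinv : IsUnit Kmat.det)
    (k : ℝ × ℝ → Fin 3 → ℝ)
    (hk : ∀ x, k x = fun j => K₁ x.1 (X j).1 + K₂ x.2 (X j).2) :
    (K₁ b₁ b₁ + K₂ b₂ b₂) - k (b₁, b₂) ⬝ᵥ (Kmat⁻¹ *ᵥ k (b₁, b₂)) = 0 := by
  have hw : k (b₁, b₂) = Kmat *ᵥ ![-1, 1, 1] := by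
    ext j
    simp only [hk, hKmat, mulVec, dotProduct, Fin.sum_univ_three, of_apply, hX,
      cons_val_zero, cons_val_one, cons_val, hsym₁ b₁, hsym₂ b₂]
    ring
  rw [hw, mulVec_mulVec, nonsing_inv_mul _ hinv, one_mulVec, ← hw]
  simp only [hk, dotProduct, Fin.sum_univ_three, hX, cons_val_zero, cons_val_one, cons_val]
  ring
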